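/- arXiv:2412.20021 — 2 statements merged into one kernel-verified Lean document; each statement's English description precedes it below -/
import Mathlib

section
/- Alternative algebras satisfy the Dong property: if A is an alternative algebra over a field k of characteristic 0 with product μ, and a, b, c are pairwise mutually μ-local formal distributions over A, then for every n ∈ ℕ both ordered pairs (a ∘_{μ,n} b, c) and (c, a ∘_{μ,n} b) are μ-local. -/
/-- The ordered pair of formal distributions `(a, b)` over `A` is `μ`-local:
there is `N` with `(w - z)^N μ(a(w), b(z)) = 0`, encoded coefficient-wise. -/
def IsLocalPair {A : Type*} [AddCommGroup A] (μ : A → A → A) (a b : ℤ → A) : Prop :=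
  ∃ N : ℕ, ∀ m p : ℤ,
    ∑ s ∈ Finset.range (N + 1),
      ((-1 : ℤ) ^ s * (N.choose s : ℤ)) • μ (a (m + (N : ℤ) - (s : ℤ))) (b (p + (s : ℤ))) = 0

/-- The `n`-th `μ`-product `a ∘_{μ,n} b` of formal distributions,
encoding `Res_{ξ=0} (ξ - w)^n μ(a(ξ), b(w))`. -/
def NthProduct {A : Type*} [AddCommGroup A] (μ : A → A → A) (n : ℕ) (a b : ℤ → A) : ℤ → A :=
  fun m => ∑ j ∈ Finset.range (n + 1),
    ((-1 : ℤ) ^ j * (n.choose j : ℤ)) • μ (a ((n : ℤ) - (j : ℤ))) (b (m + (j : ℤ)))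

/-- Three formal distributions `a, b, c` are pairwise mutually `μ`-local. -/
def PairwiseMutuallyLocal {A : Type*} [AddCommGroup A] (μ : A → A → A) (a b c : ℤ → A) : Prop :=
  IsLocalPair μ a b ∧ IsLocalPair μ b a ∧ IsLocalPair μ a c ∧ IsLocalPair μ c a ∧
    IsLocalPair μ b c ∧ IsLocalPair μ c b

/-- `μ : A → A → A` is `k`-bilinear. -/
def IsBilinear (k : Type*) [Field k] {A : Type*} [AddCommGroup A] [Module k A]
    (μ : A → A → A) : Prop :=
  (∀ x y z : A, μ (x + y) z = μ x z + μ y z) ∧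
    (∀ x y z : A, μ x (y + z) = μ x y + μ x z) ∧
    (∀ (r : k) (x y : A), μ (r • x) y = r • μ x y) ∧
    (∀ (r : k) (x y : A), μ x (r • y) = r • μ x y)

namespace DongAux

/-- `f` is annihilated by a power of the operator `P`. -/
def Killed {M : Type*} [AddCommGroup M] (P : Module.End ℤ M) (f : M) : Prop :=
  ∃ N : ℕ, (P ^ N) f = 0

lemma pow_kill_of_le {M : Type*} [AddCommGroup M] {P : Module.End ℤ M} {f : M} {N K : ℕ}
    (h : (P ^ N) f = 0) (hK : N ≤ K) : (P ^ K) f = 0 := by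
  obtain ⟨d, rfl⟩ := Nat.exists_eq_add_of_le hK
  rw [add_comm, pow_add, Module.End.mul_apply, h, map_zero]

lemma Killed.add {M : Type*} [AddCommGroup M] {P : Module.End ℤ M} {f g : M}
    (hf : Killed P f) (hg : Killed P g) : Killed P (f + g) := by
  obtain ⟨N, hN⟩ := hf
  obtain ⟨K, hK⟩ := hg
  refine ⟨N + K, ?_⟩
  rw [map_add, pow_kill_of_le hN (by omega), pow_kill_of_le hK (by omega), add_zero]

lemma Killed.neg {M : Type*} [AddCommGroup M] {P : Module.End ℤ M} {f : M}
    (hf : Killed P f) : Killed P (-f) := by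
  obtain ⟨N, hN⟩ := hf
  exact ⟨N, by rw [map_neg, hN, neg_zero]⟩

lemma Killed.symm {M : Type*} [AddCommGroup M] {P Q : Module.End ℤ M} {f : M}
    (hf : Killed (P - Q) f) : Killed (Q - P) f := by
  obtain ⟨N, hN⟩ := hf
  refine ⟨N, ?_⟩
  rw [← neg_sub P Q, neg_pow, Module.End.mul_apply, hN, map_zero]

lemma sub_pow_kill {M : Type*} [AddCommGroup M] {P Q : Module.End ℤ M} (hPQ : Commute P Q) {f : M}
    {i j : ℕ} (hP : (P ^ i) f = 0) (hQ : (Q ^ j) f = 0) : ((P - Q) ^ (i + j)) f = 0 := by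
  rw [sub_eq_add_neg, (hPQ.neg_right).add_pow', LinearMap.sum_apply]
  refine Finset.sum_eq_zero fun x hx => ?_
  rw [Finset.HasAntidiagonal.mem_antidiagonal] at hx
  rw [LinearMap.smul_apply]
  have : (P ^ x.1 * (-Q) ^ x.2) f = 0 := by
    by_cases h : i ≤ x.1
    · rw [((hPQ.neg_right).pow_pow _ _).eq, Module.End.mul_apply, pow_kill_of_le hP h, map_zero]
    · rw [neg_pow, Module.End.mul_apply, Module.End.mul_apply,
        pow_kill_of_le hQ (by omega), map_zero, map_zero]
  rw [this, smul_zero]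

/-- The support argument behind the Dong property. -/
lemma killed_main {M : Type*} [AddCommGroup M] {W U V : Module.End ℤ M} (hWU : Commute W U)
    (hV : V = W - U) {f g h : M} (hU : Killed U f) (hfg : f = g + h)
    (hg : Killed V g) (hh : Killed W h) : Killed V f := by
  obtain ⟨i, hi⟩ := hU
  obtain ⟨j, hj⟩ := hg
  obtain ⟨l, hl⟩ := hh
  have hVW : Commute V W := by
    rw [hV]; exact (Commute.refl W).sub_left hWU.symm
  have hVU : Commute V U := by
    rw [hV]; exact hWU.sub_left (Commute.refl U)
  refine ⟨(l + i) + j, ?_⟩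
  rw [pow_add, Module.End.mul_apply]
  nth_rw 1 [hV]
  apply sub_pow_kill hWU
  · rw [hfg, map_add, hj, zero_add, ← Module.End.mul_apply, ← (hVW.pow_pow j l).eq,
      Module.End.mul_apply, hl, map_zero]
  · rw [← Module.End.mul_apply, ← (hVU.pow_pow j i).eq, Module.End.mul_apply, hi, map_zero]

lemma sub_pow_apply {M : Type*} [AddCommGroup M] {P Q : Module.End ℤ M} (hPQ : Commute P Q)
    (N : ℕ) (f : M) : ((P - Q) ^ N) f =
      ∑ s ∈ Finset.range (N + 1), ((-1 : ℤ) ^ s * (N.choose s : ℤ)) • (P ^ (N - s)) ((Q ^ s) f) := by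
  have h := (hPQ.neg_right).symm.add_pow N
  rw [sub_eq_add_neg, add_comm, h, LinearMap.sum_apply]
  refine Finset.sum_congr rfl fun s _ => ?_
  have e : (-Q) ^ s * P ^ (N - s) * ((N.choose s : ℕ) : Module.End ℤ M)
      = ((-1 : ℤ) ^ s * (N.choose s : ℤ)) • (P ^ (N - s) * Q ^ s) := by
    rw [(hPQ.symm.neg_left.pow_pow s (N - s)).eq, neg_pow, zsmul_eq_mul]
    push_cast
    have h1 : Commute (P ^ (N - s)) ((-1 : Module.End ℤ M) ^ s) :=
      ((Commute.one_right _).neg_right).pow_right s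
    have h2 := (Nat.cast_commute (N.choose s) (P ^ (N - s) * Q ^ s)).eq
    rw [← mul_assoc, h1.eq, mul_assoc, mul_assoc, mul_assoc, h2, mul_assoc]
  rw [e, LinearMap.smul_apply, Module.End.mul_apply]

variable {A : Type*} [AddCommGroup A]

/-- Three-variable formal distributions. -/
abbrev Tri (A : Type*) := ℤ → ℤ → ℤ → A

/-- Multiplication by the first variable. -/
def SX : Module.End ℤ (Tri A) where
  toFun f := fun i j l => f (i + 1) j l
  map_add' _ _ := rfl
  map_smul' _ _ := rfl

/-- Multiplication by the second variable. -/
def SY : Module.End ℤ (Tri A) where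
  toFun f := fun i j l => f i (j + 1) l
  map_add' _ _ := rfl
  map_smul' _ _ := rfl

/-- Multiplication by the third variable. -/
def SZ : Module.End ℤ (Tri A) where
  toFun f := fun i j l => f i j (l + 1)
  map_add' _ _ := rfl
  map_smul' _ _ := rfl

lemma SX_pow (N : ℕ) (f : Tri A) (i j l : ℤ) : ((SX : Module.End ℤ (Tri A)) ^ N) f i j l = f (i + N) j l := by
  induction N generalizing i with
  | zero => simp
  | succ N ih =>
    rw [pow_succ', Module.End.mul_apply]
    change ((SX : Module.End ℤ (Tri A)) ^ N) f (i + 1) j l = _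
    rw [ih]; congr 1; push_cast; ring

lemma SY_pow (N : ℕ) (f : Tri A) (i j l : ℤ) : ((SY : Module.End ℤ (Tri A)) ^ N) f i j l = f i (j + N) l := by
  induction N generalizing j with
  | zero => simp
  | succ N ih =>
    rw [pow_succ', Module.End.mul_apply]
    change ((SY : Module.End ℤ (Tri A)) ^ N) f i (j + 1) l = _
    rw [ih]; congr 1; push_cast; ring

lemma SZ_pow (N : ℕ) (f : Tri A) (i j l : ℤ) : ((SZ : Module.End ℤ (Tri A)) ^ N) f i j l = f i j (l + N) := by
  induction N generalizing l with
  | zero => simp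
  | succ N ih =>
    rw [pow_succ', Module.End.mul_apply]
    change ((SZ : Module.End ℤ (Tri A)) ^ N) f i j (l + 1) = _
    rw [ih]; congr 1; push_cast; ring

lemma cXY : Commute (SX : Module.End ℤ (Tri A)) SY := rfl
lemma cXZ : Commute (SX : Module.End ℤ (Tri A)) SZ := rfl
lemma cYZ : Commute (SY : Module.End ℤ (Tri A)) SZ := rfl

lemma killed_XY {μ : A → A → A} {a b : ℤ → A} (h : IsLocalPair μ a b) (φ : ℤ → A →+ A) :
    Killed (SX - SY) (fun i j l => φ l (μ (a i) (b j)) : Tri A) := by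
  obtain ⟨N, hN⟩ := h
  refine ⟨N, ?_⟩
  rw [sub_pow_apply cXY]
  ext i j l
  have := congrArg (φ l) (hN i j)
  rw [map_sum, map_zero] at this
  simp only [Finset.sum_apply, Pi.smul_apply, SX_pow, SY_pow, Pi.zero_apply]
  rw [← this]
  refine Finset.sum_congr rfl fun s hs => ?_
  have hs' : s ≤ N := by simpa [Nat.lt_succ_iff] using hs
  rw [map_zsmul, Nat.cast_sub hs', add_sub_assoc]

lemma killed_XZ {μ : A → A → A} {a c : ℤ → A} (h : IsLocalPair μ a c) (φ : ℤ → A →+ A) :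
    Killed (SX - SZ) (fun i j l => φ j (μ (a i) (c l)) : Tri A) := by
  obtain ⟨N, hN⟩ := h
  refine ⟨N, ?_⟩
  rw [sub_pow_apply cXZ]
  ext i j l
  have := congrArg (φ j) (hN i l)
  rw [map_sum, map_zero] at this
  simp only [Finset.sum_apply, Pi.smul_apply, SX_pow, SZ_pow, Pi.zero_apply]
  rw [← this]
  refine Finset.sum_congr rfl fun s hs => ?_
  have hs' : s ≤ N := by simpa [Nat.lt_succ_iff] using hs
  rw [map_zsmul, Nat.cast_sub hs', add_sub_assoc]

lemma killed_ZX {μ : A → A → A} {a c : ℤ → A} (h : IsLocalPair μ c a) (φ : ℤ → A →+ A) :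
    Killed (SX - SZ) (fun i j l => φ j (μ (c l) (a i)) : Tri A) := by
  apply Killed.symm
  obtain ⟨N, hN⟩ := h
  refine ⟨N, ?_⟩
  rw [sub_pow_apply cXZ.symm]
  ext i j l
  have := congrArg (φ j) (hN l i)
  rw [map_sum, map_zero] at this
  simp only [Finset.sum_apply, Pi.smul_apply, SX_pow, SZ_pow, Pi.zero_apply]
  rw [← this]
  refine Finset.sum_congr rfl fun s hs => ?_
  have hs' : s ≤ N := by simpa [Nat.lt_succ_iff] using hs
  rw [map_zsmul, Nat.cast_sub hs', add_sub_assoc]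

lemma killed_YZ {μ : A → A → A} {b c : ℤ → A} (h : IsLocalPair μ b c) (φ : ℤ → A →+ A) :
    Killed (SY - SZ) (fun i j l => φ i (μ (b j) (c l)) : Tri A) := by
  obtain ⟨N, hN⟩ := h
  refine ⟨N, ?_⟩
  rw [sub_pow_apply cYZ]
  ext i j l
  have := congrArg (φ i) (hN j l)
  rw [map_sum, map_zero] at this
  simp only [Finset.sum_apply, Pi.smul_apply, SY_pow, SZ_pow, Pi.zero_apply]
  rw [← this]
  refine Finset.sum_congr rfl fun s hs => ?_
  have hs' : s ≤ N := by simpa [Nat.lt_succ_iff] using hs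
  rw [map_zsmul, Nat.cast_sub hs', add_sub_assoc]

lemma killed_ZY {μ : A → A → A} {b c : ℤ → A} (h : IsLocalPair μ c b) (φ : ℤ → A →+ A) :
    Killed (SY - SZ) (fun i j l => φ i (μ (c l) (b j)) : Tri A) := by
  apply Killed.symm
  obtain ⟨N, hN⟩ := h
  refine ⟨N, ?_⟩
  rw [sub_pow_apply cYZ.symm]
  ext i j l
  have := congrArg (φ i) (hN l j)
  rw [map_sum, map_zero] at this
  simp only [Finset.sum_apply, Pi.smul_apply, SY_pow, SZ_pow, Pi.zero_apply]
  rw [← this]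
  refine Finset.sum_congr rfl fun s hs => ?_
  have hs' : s ≤ N := by simpa [Nat.lt_succ_iff] using hs
  rw [map_zsmul, Nat.cast_sub hs', add_sub_assoc]

lemma local_left {μ : A → A → A} (L : A → A →+ A) (hL : ∀ x y, L x y = μ y x) {a b c : ℤ → A}
    (h : Killed (SY - SZ) (fun i j l => μ (μ (a i) (b j)) (c l) : Tri A)) (n : ℕ) :
    IsLocalPair μ (NthProduct μ n a b) c := by
  obtain ⟨N, hN⟩ := h
  refine ⟨N, fun m p => ?_⟩
  have key : ∀ i j l : ℤ, ∑ s ∈ Finset.range (N + 1), ((-1 : ℤ) ^ s * (N.choose s : ℤ)) •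
      μ (μ (a i) (b (j + (N - s)))) (c (l + s)) = 0 := by
    intro i j l
    have := congrFun (congrFun (congrFun hN i) j) l
    rw [sub_pow_apply cYZ] at this
    simp only [Finset.sum_apply, Pi.smul_apply, SY_pow, SZ_pow, Pi.zero_apply] at this
    rw [← this]
    refine Finset.sum_congr rfl fun s hs => ?_
    have hs' : s ≤ N := by simpa [Nat.lt_succ_iff] using hs
    rw [Nat.cast_sub hs']
  have e : ∀ s ∈ Finset.range (N + 1), ((-1 : ℤ) ^ s * (N.choose s : ℤ)) •
      μ (NthProduct μ n a b (m + N - s)) (c (p + s)) =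
      ∑ j ∈ Finset.range (n + 1), ((-1 : ℤ) ^ j * (n.choose j : ℤ)) •
        (((-1 : ℤ) ^ s * (N.choose s : ℤ)) •
          μ (μ (a (n - j)) (b (m + j + (N - s)))) (c (p + s))) := by
    intro s _
    rw [← hL, NthProduct, map_sum, Finset.smul_sum]
    refine Finset.sum_congr rfl fun j _ => ?_
    rw [map_zsmul, smul_comm, hL]
    congr 5; ring
  rw [Finset.sum_congr rfl e, Finset.sum_comm]
  refine Finset.sum_eq_zero fun j _ => ?_
  rw [← Finset.smul_sum, key, smul_zero]

lemma local_right {μ : A → A → A} (L : A → A →+ A) (hL : ∀ x y, L x y = μ x y) {a b c : ℤ → A}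
    (h : Killed (SY - SZ) (fun i j l => μ (c l) (μ (a i) (b j)) : Tri A)) (n : ℕ) :
    IsLocalPair μ c (NthProduct μ n a b) := by
  obtain ⟨N, hN⟩ := h.symm
  refine ⟨N, fun m p => ?_⟩
  have key : ∀ i j l : ℤ, ∑ s ∈ Finset.range (N + 1), ((-1 : ℤ) ^ s * (N.choose s : ℤ)) •
      μ (c (l + N - s)) (μ (a i) (b (j + s))) = 0 := by
    intro i j l
    have := congrFun (congrFun (congrFun hN i) j) l
    rw [sub_pow_apply cYZ.symm] at this
    simp only [Finset.sum_apply, Pi.smul_apply, SY_pow, SZ_pow, Pi.zero_apply] at this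
    rw [← this]
    refine Finset.sum_congr rfl fun s hs => ?_
    have hs' : s ≤ N := by simpa [Nat.lt_succ_iff] using hs
    rw [Nat.cast_sub hs', add_sub_assoc]
  have e : ∀ s ∈ Finset.range (N + 1), ((-1 : ℤ) ^ s * (N.choose s : ℤ)) •
      μ (c (m + N - s)) (NthProduct μ n a b (p + s)) =
      ∑ j ∈ Finset.range (n + 1), ((-1 : ℤ) ^ j * (n.choose j : ℤ)) •
        (((-1 : ℤ) ^ s * (N.choose s : ℤ)) •
          μ (c (m + N - s)) (μ (a (n - j)) (b (p + j + s)))) := by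
    intro s _
    rw [← hL, NthProduct, map_sum, Finset.smul_sum]
    refine Finset.sum_congr rfl fun j _ => ?_
    rw [map_zsmul, smul_comm, hL]
    congr 5; ring
  rw [Finset.sum_congr rfl e, Finset.sum_comm]
  refine Finset.sum_eq_zero fun j _ => ?_
  rw [← Finset.smul_sum, key, smul_zero]

end DongAux

/-- Alternative algebras satisfy the Dong property. -/
theorem alternative_dong_property (k : Type*) [Field k] [CharZero k]
    (A : Type*) [AddCommGroup A] [Module k A]
    (μ : A → A → A) (hbil : IsBilinear k μ)
    (halt1 : ∀ x y z : A, μ (μ x y) z - μ x (μ y z) = -(μ (μ y x) z) + μ y (μ x z))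
    (halt2 : ∀ x y z : A, μ (μ x y) z - μ x (μ y z) = -(μ (μ x z) y) + μ x (μ z y))
    (a b c : ℤ → A) (hloc : PairwiseMutuallyLocal μ a b c) (n : ℕ) :
    IsLocalPair μ (NthProduct μ n a b) c ∧ IsLocalPair μ c (NthProduct μ n a b) := by
  obtain ⟨hadd1, hadd2, -, -⟩ := hbil
  obtain ⟨hab, -, hac, hca, hbc, hcb⟩ := hloc
  let Lm : A → A →+ A := fun x => AddMonoidHom.mk' (fun y => μ x y) (hadd2 x)
  let Rm : A → A →+ A := fun x => AddMonoidHom.mk' (fun y => μ y x) (fun y z => hadd1 y z x)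
  have hc : Commute (DongAux.SX - DongAux.SZ : Module.End ℤ (DongAux.Tri A))
      (DongAux.SX - DongAux.SY) :=
    ((Commute.refl _).sub_right DongAux.cXY).sub_left
      (DongAux.cXZ.symm.sub_right DongAux.cYZ.symm)
  have hV : (DongAux.SY - DongAux.SZ : Module.End ℤ (DongAux.Tri A)) =
      (DongAux.SX - DongAux.SZ) - (DongAux.SX - DongAux.SY) := by abel
  constructor
  · refine DongAux.local_left Rm (fun _ _ => rfl) ?_ n
    refine DongAux.killed_main hc hV (DongAux.killed_XY hab fun l => Rm (c l)) ?_
      ((DongAux.killed_YZ hbc fun i => Lm (a i)).add (DongAux.killed_ZY hcb fun i => Lm (a i)))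
      (DongAux.killed_XZ hac fun j => Rm (b j)).neg
    ext i j l
    change μ (μ (a i) (b j)) (c l) = μ (a i) (μ (b j) (c l)) + μ (a i) (μ (c l) (b j))
      + -(μ (μ (a i) (c l)) (b j))
    rw [sub_eq_iff_eq_add.mp (halt2 (a i) (b j) (c l))]
    abel
  · refine DongAux.local_right Lm (fun _ _ => rfl) ?_ n
    refine DongAux.killed_main hc hV (DongAux.killed_XY hab fun l => Lm (c l)) ?_
      (DongAux.killed_ZY hcb fun i => Lm (a i)).neg
      ((DongAux.killed_ZX hca fun j => Rm (b j)).add (DongAux.killed_XZ hac fun j => Rm (b j)))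
    ext i j l
    change μ (c l) (μ (a i) (b j)) = -(μ (a i) (μ (c l) (b j))) + (μ (μ (c l) (a i)) (b j)
      + μ (μ (a i) (c l)) (b j))
    rw [sub_eq_iff_eq_add.mp (halt1 (c l) (a i) (b j))]
    abel
end

section
/- Leibniz algebras satisfy the Dong property (the di-replication of the Lie case): if A is a Leibniz algebra over a field k of characteristic 0 with bracket β, and a, b, c are pairwise mutually β-local formal distributions over A, then for every n ∈ ℕ both ordered pairs (a ∘_{β,n} b, c) and (c, a ∘_{β,n} b) are β-local. -/
/-- The shift representation of `ℤ³` on functions `ℤ³ → A`. -/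
def dongShift (A : Type*) [AddCommGroup A] :
    Multiplicative (ℤ × ℤ × ℤ) →* Module.End ℤ (ℤ × ℤ × ℤ → A) where
  toFun e :=
    { toFun := fun F g => F (g + e.toAdd)
      map_add' := fun _ _ => rfl
      map_smul' := fun _ _ => rfl }
  map_one' := by
    ext F g
    simp
  map_mul' e f := by
    ext F g
    simp only [Module.End.mul_apply, LinearMap.coe_mk, AddHom.coe_mk, toAdd_mul]
    rw [add_assoc]

/-- The action of Laurent polynomials on functions `ℤ³ → A`. -/
noncomputable def dongAct (A : Type*) [AddCommGroup A] :
    AddMonoidAlgebra ℤ (ℤ × ℤ × ℤ) →ₐ[ℤ] Module.End ℤ (ℤ × ℤ × ℤ → A) :=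
  AddMonoidAlgebra.lift ℤ _ _ (dongShift A)

/-- A monomial. -/
noncomputable def dongX (e : ℤ × ℤ × ℤ) : AddMonoidAlgebra ℤ (ℤ × ℤ × ℤ) :=
  AddMonoidAlgebra.single e 1

theorem dongAct_X {A : Type*} [AddCommGroup A] (e g : ℤ × ℤ × ℤ) (F : ℤ × ℤ × ℤ → A) :
    dongAct A (dongX e) F g = F (g + e) := by
  simp [dongAct, dongX, dongShift]

theorem dongX_pow (e : ℤ × ℤ × ℤ) (n : ℕ) : dongX e ^ n = dongX (n • e) := by
  simp [dongX, AddMonoidAlgebra.single_pow]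

theorem dongX_mul (e f : ℤ × ℤ × ℤ) : dongX e * dongX f = dongX (e + f) := by
  simp [dongX, AddMonoidAlgebra.single_mul_single]

theorem dongAct_sub_pow {A : Type*} [AddCommGroup A] (e f g : ℤ × ℤ × ℤ) (N : ℕ)
    (F : ℤ × ℤ × ℤ → A) :
    dongAct A ((dongX e - dongX f) ^ N) F g =
      ∑ s ∈ Finset.range (N + 1), ((-1 : ℤ) ^ s * (N.choose s : ℤ)) •
        F (g + ((N : ℤ) - (s : ℤ)) • e + (s : ℤ) • f) := by
  have h : (dongX e - dongX f) ^ N = ∑ s ∈ Finset.range (N + 1),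
      ((-1 : ℤ) ^ s * (N.choose s : ℤ)) • dongX ((N - s) • e + s • f) := by
    rw [sub_eq_neg_add, add_pow]
    refine Finset.sum_congr rfl fun s _ => ?_
    rw [neg_pow, ← dongX_mul, ← dongX_pow, ← dongX_pow, zsmul_eq_mul]
    push_cast
    ring
  rw [h, map_sum, LinearMap.sum_apply, Finset.sum_apply]
  refine Finset.sum_congr rfl fun s hs => ?_
  rw [map_zsmul, LinearMap.smul_apply, Pi.smul_apply, dongAct_X]
  have hs' : s ≤ N := Nat.lt_succ_iff.mp (Finset.mem_range.mp hs)
  rw [← add_assoc, ← natCast_zsmul e, ← natCast_zsmul f, Nat.cast_sub hs']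

theorem dong_kill {A R : Type*} [AddCommGroup A] [CommRing R]
    (φ : R →+* Module.End ℤ A) (u v w e : R) (F F₂ F₃ : A) (N₁ N₂ N₃ : ℕ)
    (hF : F = F₂ + F₃) (hv : v = w + e * u)
    (h₁ : φ (u ^ N₁) F = 0) (h₂ : φ (v ^ N₂) F₂ = 0) (h₃ : φ (w ^ N₃) F₃ = 0) :
    φ (v ^ (N₂ + (N₃ + N₁))) F = 0 := by
  have hm : v ^ (N₃ + N₁) ∈ Ideal.span {w ^ N₃, u ^ N₁} := by
    rw [hv]
    refine Ideal.add_pow_mem_of_pow_mem_of_le (m := N₃) (n := N₁) _ ?_ ?_ (by omega)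
    · exact Ideal.subset_span (by simp)
    · rw [mul_pow]
      exact Ideal.mul_mem_left _ _ (Ideal.subset_span (by simp))
  obtain ⟨p, q, hpq⟩ := Ideal.mem_span_pair.mp hm
  have key : v ^ (N₂ + (N₃ + N₁)) = p * w ^ N₃ * v ^ N₂ + v ^ N₂ * q * u ^ N₁ := by
    rw [pow_add, ← hpq]; ring
  have k₂ : φ (p * w ^ N₃ * v ^ N₂) F₂ = 0 := by
    rw [map_mul, Module.End.mul_apply, h₂, map_zero]
  have k₃ : φ (p * w ^ N₃ * v ^ N₂) F₃ = 0 := by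
    rw [mul_right_comm, map_mul, Module.End.mul_apply, h₃, map_zero]
  have k₁ : φ (v ^ N₂ * q * u ^ N₁) F = 0 := by
    rw [map_mul, Module.End.mul_apply, h₁, map_zero]
  rw [key, map_add, LinearMap.add_apply, k₁, hF, map_add, k₂, k₃]
  simp

/-- Leibniz algebras satisfy the Dong property. -/
theorem leibniz_dong_property (k : Type*) [Field k] [CharZero k]
    (A : Type*) [AddCommGroup A] [Module k A]
    (β : A → A → A) (hbil : IsBilinear k β)
    (hleib : ∀ x y z : A, β x (β y z) = β (β x y) z + β y (β x z))
    (a b c : ℤ → A) (hloc : PairwiseMutuallyLocal β a b c) (n : ℕ) :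
    IsLocalPair β (NthProduct β n a b) c ∧ IsLocalPair β c (NthProduct β n a b) := by
  obtain ⟨hadd₁, hadd₂, -, -⟩ := hbil
  let L : A → A →+ A := fun y => AddMonoidHom.mk' (fun x => β x y) (fun _ _ => hadd₁ _ _ _)
  let R : A → A →+ A := fun x => AddMonoidHom.mk' (fun y => β x y) (fun _ _ => hadd₂ _ _ _)
  have hL : ∀ (N : ℕ) (r : ℕ → ℤ) (f : ℕ → A) (y : A),
      β (∑ s ∈ Finset.range N, r s • f s) y = ∑ s ∈ Finset.range N, r s • β (f s) y := by
    intro N r f y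
    have := map_sum (L y) (fun s => r s • f s) (Finset.range N)
    simp only [map_zsmul] at this
    exact this
  have hR : ∀ (N : ℕ) (r : ℕ → ℤ) (f : ℕ → A) (x : A),
      β x (∑ s ∈ Finset.range N, r s • f s) = ∑ s ∈ Finset.range N, r s • β x (f s) := by
    intro N r f x
    have := map_sum (R x) (fun s => r s • f s) (Finset.range N)
    simp only [map_zsmul] at this
    exact this
  have hL0 : ∀ y, β 0 y = 0 := fun y => map_zero (L y)
  have hR0 : ∀ x, β x 0 = 0 := fun x => map_zero (R x)
  obtain ⟨⟨Nab, hab⟩, -, ⟨Nac, hac⟩, ⟨Nca, hca⟩, ⟨Nbc, hbc⟩, ⟨Ncb, hcb⟩⟩ := hloc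
  let x := dongX (1, 0, 0)
  let y := dongX (0, 1, 0)
  let z := dongX (0, 0, 1)
  constructor
  · let T : ℤ × ℤ × ℤ → A := fun g => β (β (a g.1) (b g.2.1)) (c g.2.2)
    let T₂ : ℤ × ℤ × ℤ → A := fun g => β (a g.1) (β (b g.2.1) (c g.2.2))
    let T₃ : ℤ × ℤ × ℤ → A := fun g => β (b g.2.1) (β (a g.1) (c g.2.2))
    have h := dong_kill (dongAct A).toRingHom (x - y) (y - z) (x - z) (-1) T T₂ (-T₃) Nab Nbc Nac
      (by
        funext g
        simp only [T, T₂, T₃, Pi.add_apply, Pi.neg_apply, hleib (a g.1) (b g.2.1) (c g.2.2)]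
        abel) (by ring)
      (by
        funext ⟨i, j, l⟩
        refine (dongAct_sub_pow _ _ _ _ _).trans ?_
        have := hL (Nab + 1) (fun s => (-1 : ℤ) ^ s * (Nab.choose s : ℤ)) (fun s =>
          β (a (i + (Nab : ℤ) - (s : ℤ))) (b (j + (s : ℤ)))) (c l)
        rw [hab, hL0] at this
        simpa [T, add_sub_assoc] using this.symm)
      (by
        funext ⟨i, j, l⟩
        refine (dongAct_sub_pow _ _ _ _ _).trans ?_
        have := hR (Nbc + 1) (fun s => (-1 : ℤ) ^ s * (Nbc.choose s : ℤ)) (fun s =>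
          β (b (j + (Nbc : ℤ) - (s : ℤ))) (c (l + (s : ℤ)))) (a i)
        rw [hbc, hR0] at this
        simpa [T₂, add_sub_assoc] using this.symm)
      (by
        rw [map_neg, neg_eq_zero]
        funext ⟨i, j, l⟩
        refine (dongAct_sub_pow _ _ _ _ _).trans ?_
        have := hR (Nac + 1) (fun s => (-1 : ℤ) ^ s * (Nac.choose s : ℤ)) (fun s =>
          β (a (i + (Nac : ℤ) - (s : ℤ))) (c (l + (s : ℤ)))) (b j)
        rw [hac, hR0] at this
        simpa [T₃, add_sub_assoc] using this.symm)
    refine ⟨Nbc + (Nac + Nab), fun m p => ?_⟩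
    generalize Nbc + (Nac + Nab) = M at h ⊢
    have h' : dongAct A ((y - z) ^ M) (dongAct A ((x - y) ^ n) T) (0, m, p) = 0 := by
      rw [← Module.End.mul_apply, ← map_mul, mul_comm, map_mul, Module.End.mul_apply]
      have h0 : dongAct A ((y - z) ^ M) T = 0 := h
      rw [h0, map_zero]
      rfl
    rw [dongAct_sub_pow] at h'
    rw [← h']
    refine Finset.sum_congr rfl fun s _ => ?_
    rw [dongAct_sub_pow, NthProduct, hL]
    simp [T, add_sub_assoc]
  · let T : ℤ × ℤ × ℤ → A := fun g => β (c g.2.2) (β (a g.1) (b g.2.1))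
    let T₂ : ℤ × ℤ × ℤ → A := fun g => β (a g.1) (β (c g.2.2) (b g.2.1))
    let T₃ : ℤ × ℤ × ℤ → A := fun g => β (β (c g.2.2) (a g.1)) (b g.2.1)
    have h := dong_kill (dongAct A).toRingHom (x - y) (z - y) (z - x) 1 T T₂ T₃ Nab Ncb Nca
      (by
        funext g
        simp only [T, T₂, T₃, Pi.add_apply, hleib (c g.2.2) (a g.1) (b g.2.1)]
        abel) (by ring)
      (by
        funext ⟨i, j, l⟩
        refine (dongAct_sub_pow _ _ _ _ _).trans ?_
        have := hR (Nab + 1) (fun s => (-1 : ℤ) ^ s * (Nab.choose s : ℤ)) (fun s =>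
          β (a (i + (Nab : ℤ) - (s : ℤ))) (b (j + (s : ℤ)))) (c l)
        rw [hab, hR0] at this
        simpa [T, add_sub_assoc] using this.symm)
      (by
        funext ⟨i, j, l⟩
        refine (dongAct_sub_pow _ _ _ _ _).trans ?_
        have := hR (Ncb + 1) (fun s => (-1 : ℤ) ^ s * (Ncb.choose s : ℤ)) (fun s =>
          β (c (l + (Ncb : ℤ) - (s : ℤ))) (b (j + (s : ℤ)))) (a i)
        rw [hcb, hR0] at this
        simpa [T₂, add_sub_assoc] using this.symm)
      (by
        funext ⟨i, j, l⟩
        refine (dongAct_sub_pow _ _ _ _ _).trans ?_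
        have := hL (Nca + 1) (fun s => (-1 : ℤ) ^ s * (Nca.choose s : ℤ)) (fun s =>
          β (c (l + (Nca : ℤ) - (s : ℤ))) (a (i + (s : ℤ)))) (b j)
        rw [hca, hL0] at this
        simpa [T₃, add_sub_assoc] using this.symm)
    refine ⟨Ncb + (Nca + Nab), fun m p => ?_⟩
    generalize Ncb + (Nca + Nab) = M at h ⊢
    have h' : dongAct A ((z - y) ^ M) (dongAct A ((x - y) ^ n) T) (0, p, m) = 0 := by
      rw [← Module.End.mul_apply, ← map_mul, mul_comm, map_mul, Module.End.mul_apply]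
      have h0 : dongAct A ((z - y) ^ M) T = 0 := h
      rw [h0, map_zero]
      rfl
    rw [dongAct_sub_pow] at h'
    rw [← h']
    refine Finset.sum_congr rfl fun s _ => ?_
    rw [dongAct_sub_pow, NthProduct, hR]
    simp [T, add_sub_assoc]
end
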